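/- Let B be a finite skew brace of nilpotent type such that the multiplicative group (B,·) is nilpotent and b∗b = 0 for all b ∈ B. Then B is centrally nilpotent. -/

import Mathlib

/-- A (left) skew brace: a set with two group structures `(B,+)` and `(B,·)`
satisfying `a · (b + c) = a · b - a + a · c`. -/
class SkewBrace (B : Type*) extends AddGroup B, Group B where
  skew : ∀ a b c : B, a * (b + c) = a * b - a + a * c

/-- The star product of a skew brace: `a ∗ b = -a + a·b - b`. -/
def sstar {B : Type*} [SkewBrace B] (a b : B) : B := -a + a * b - b

/-- The upper central series of a skew brace, defined elementwise:
`zeta B 0 = {0}` and `x ∈ zeta B (n+1)` iff the image of `x` in the quotient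
`B / zeta B n` lies in `ζ(B/zeta B n) = Soc(B/zeta B n) ∩ Z(B/zeta B n, ·)`,
i.e. iff for all `b`, `x·b ≡ x + b` (so `x` is in the kernel of the `λ`-map of
the quotient), `x + b ≡ b + x` and `x·b ≡ b·x` modulo `zeta B n`. -/
def zeta (B : Type*) [SkewBrace B] : ℕ → Set B
  | 0 => {0}
  | n + 1 =>
    {x | ∀ b : B,
      -(x * b) + (x + b) ∈ zeta B n ∧
      -(x + b) + (b + x) ∈ zeta B n ∧
      (x * b)⁻¹ * (b * x) ∈ zeta B n}

/-- A skew brace is centrally nilpotent if its upper central series reaches `B`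
after finitely many steps. -/
def CentrallyNilpotent (B : Type*) [SkewBrace B] : Prop :=
  ∃ n : ℕ, zeta B n = Set.univ

namespace SkewBrace

variable {B : Type*} [SkewBrace B]

theorem mul_zero_eq (a : B) : a * 0 = a := by
  have h := skew a 0 0
  rw [add_zero] at h
  have h' : a * 0 + (-a + a * 0) = a * 0 + 0 := by
    rw [add_zero, ← add_assoc, ← sub_eq_add_neg]
    exact h.symm
  have h'' := add_left_cancel h'
  exact (neg_add_eq_zero.mp h'').symm

theorem one_eq_zero : (1 : B) = 0 := by
  rw [← mul_zero_eq (1 : B), one_mul]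

theorem mul_neg_eq (a b : B) : a * (-b) = a - a * b + a := by
  have h := skew a b (-b)
  rw [add_neg_cancel, mul_zero_eq] at h
  have h' : -(a * b - a) + a = a * (-b) := by
    rw [neg_add_eq_iff_eq_add]
    exact h
  rw [← h', neg_sub]

/-- The homomorphism `λ` from the multiplicative group to the endomorphisms of the additive
group. -/
def lam (B : Type*) [SkewBrace B] : B →* AddMonoid.End B where
  toFun a :=
    { toFun := fun b => -a + a * b
      map_zero' := by rw [mul_zero_eq, neg_add_cancel]
      map_add' := fun b c => by simp only [skew, sub_eq_add_neg, add_assoc] }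
  map_one' := by
    ext b
    change -1 + 1 * b = b
    rw [one_mul, one_eq_zero, neg_zero, zero_add]
  map_mul' a b := by
    ext c
    change -(a * b) + a * b * c = -a + a * (-b + b * c)
    rw [skew, mul_neg_eq]
    simp only [sub_eq_add_neg, add_assoc, neg_add_cancel_left, add_neg_cancel_left, mul_assoc]

theorem mul_eq_add_lam (a b : B) : a * b = a + lam B a b :=
  (add_neg_cancel_left a (a * b)).symm

theorem lam_mul (a b c : B) : lam B (a * b) c = lam B a (lam B b c) := by
  rw [map_mul]; rfl

theorem lam_one (a : B) : lam B 1 a = a := by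
  rw [map_one]; rfl

theorem lam_self (hstar : ∀ b : B, sstar b b = 0) (b : B) : lam B b b = b :=
  sub_eq_zero.mp (hstar b)

theorem lam_injective (a : B) : Function.Injective (lam B a) := fun b c h => by
  have := congrArg (lam B a⁻¹) h
  rwa [← lam_mul, ← lam_mul, inv_mul_cancel, lam_one, lam_one] at this

theorem pow_eq_nsmul (hstar : ∀ b : B, sstar b b = 0) (b : B) (n : ℕ) : b ^ n = n • b := by
  induction n with
  | zero => rw [pow_zero, zero_nsmul, one_eq_zero]
  | succ n ih => rw [pow_succ', ih, mul_eq_add_lam, map_nsmul, lam_self hstar, succ_nsmul']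

/-- In a skew brace with `b ∗ b = 0`, an element fixed by every `λ_b` lies in the kernel of `λ`. -/
theorem lam_eq_of_fixed (hstar : ∀ b : B, sstar b b = 0) {a : B}
    (ha : ∀ b, lam B b a = a) (b : B) : lam B a b = b := by
  have h := lam_self hstar (b * a)
  rw [lam_mul, mul_eq_add_lam b a, ha, map_add, map_add, ha, ha] at h
  exact lam_injective b ((add_right_cancel h).trans (lam_self hstar b).symm)

theorem mem_zeta_one {x : B} :
    x ∈ zeta B 1 ↔ ∀ b : B, x * b = x + b ∧ x + b = b + x ∧ x * b = b * x := by
  change (∀ b : B, -(x * b) + (x + b) = 0 ∧ -(x + b) + (b + x) = 0 ∧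
    (x * b)⁻¹ * (b * x) = 0) ↔ _
  simp only [← one_eq_zero (B := B), inv_mul_eq_one]
  simp only [one_eq_zero (B := B), neg_add_eq_zero]

theorem lam_central {a : B} (ha : ∀ y, a + y = y + a) (b y : B) :
    lam B b a + y = y + lam B b a := by
  have h := congrArg (lam B b) (ha (lam B b⁻¹ y))
  rwa [map_add, map_add, ← lam_mul, mul_inv_cancel, lam_one] at h

/-- The elements of additive order dividing `p` in the centre of the additive group. -/
def centralTorsion (B : Type*) [SkewBrace B] (p : ℕ) : AddSubgroup B where
  carrier := {x | (∀ y, x + y = y + x) ∧ p • x = 0}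
  zero_mem' := ⟨fun y => by rw [zero_add, add_zero], nsmul_zero p⟩
  add_mem' := fun {a b} ha hb => ⟨fun y => by
    rw [add_assoc, hb.1, ← add_assoc, ha.1, add_assoc], by
    rw [AddCommute.add_nsmul (ha.1 b), ha.2, hb.2, add_zero]⟩
  neg_mem' := fun {a} ha => ⟨fun y => by
    rw [neg_add_eq_iff_eq_add, ← add_assoc, ha.1, add_neg_cancel_right], by
    rw [neg_nsmul, ha.2, neg_zero]⟩

instance (p : ℕ) : MulAction B (centralTorsion B p) where
  smul b a := ⟨lam B b a, lam_central a.2.1 b, by rw [← map_nsmul, a.2.2, map_zero]⟩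
  one_smul a := Subtype.ext (lam_one _)
  mul_smul b c a := Subtype.ext (lam_mul b c _)

theorem coe_smul {p : ℕ} (b : B) (a : centralTorsion B p) :
    ((b • a : centralTorsion B p) : B) = lam B b a := rfl

theorem smul_eq_of_commute (hstar : ∀ b : B, sstar b b = 0) {p m : ℕ} (hpm : p.Coprime m)
    (a : centralTorsion B p) {b : B} (hb : b ^ m = 1) (hab : Commute (a : B) b) : b • a = a := by
  set c : centralTorsion B p := a - b • a with hc
  have hcb : (c : B) + lam B a b = b := by
    have h : (a : B) * b = b * a := hab
    rw [mul_eq_add_lam, mul_eq_add_lam, ← coe_smul, ← (b • a).2.1] at h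
    rw [hc, sub_eq_add_neg, AddSubgroup.coe_add, a.2.1, AddSubgroup.coe_neg, add_assoc, h,
      neg_add_cancel_left]
  have hm : m • (c : B) = 0 := by
    have hb' : m • b = 0 := by rw [← pow_eq_nsmul hstar, hb, one_eq_zero]
    have h := hb'
    rw [← hcb, AddCommute.add_nsmul (c.2.1 _), ← map_nsmul, hb', map_zero, add_zero] at h
    exact h
  have h1 : addOrderOf (c : B) ∣ 1 := by
    rw [← hpm]
    exact Nat.dvd_gcd (addOrderOf_dvd_of_nsmul_eq_zero c.2.2) (addOrderOf_dvd_of_nsmul_eq_zero hm)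
  have h0 : (c : B) = 0 := AddMonoid.addOrderOf_eq_one_iff.mp (Nat.dvd_one.mp h1)
  exact (sub_eq_zero.mp (Subtype.ext h0 : c = 0)).symm

theorem exists_prime_dvd_card_centralTorsion [Finite B] [Nontrivial B]
    (hnil : Group.IsNilpotent (Multiplicative B)) :
    ∃ p : ℕ, p.Prime ∧ p ∣ Nat.card (centralTorsion B p) := by
  have : Nontrivial (Subgroup.center (Multiplicative B)) :=
    (Subgroup.nontrivial_iff_ne_bot _).mpr (Group.IsNilpotent.center_ne_bot _)
  obtain ⟨p, hp, hdvd⟩ := Nat.exists_prime_and_dvd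
    (Finite.one_lt_card (α := Subgroup.center (Multiplicative B))).ne'
  have : Fact p.Prime := ⟨hp⟩
  obtain ⟨x, hx⟩ := exists_prime_orderOf_dvd_card' p hdvd
  have hxc : ∀ y : B, (x.1).toAdd + y = y + (x.1).toAdd := fun y =>
    (congrArg Multiplicative.toAdd (Subgroup.mem_center_iff.mp x.2 (Multiplicative.ofAdd y))).symm
  have hox : addOrderOf (x.1).toAdd = p := by
    rw [← hx, ← Subgroup.orderOf_coe]; rfl
  let z : centralTorsion B p := ⟨(x.1).toAdd, hxc, by rw [← hox]; exact addOrderOf_nsmul_eq_zero _⟩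
  refine ⟨p, hp, ?_⟩
  have hz : addOrderOf z = p := by rw [← AddSubgroup.addOrderOf_coe]; exact hox
  exact (dvd_of_eq hz.symm).trans (addOrderOf_dvd_natCard z)

theorem _root_.Subgroup.eq_top_of_forall_sylow_le {G : Type*} [Group G] [Finite G] (H : Subgroup G)
    (h : ∀ q : ℕ, q.Prime → ∃ P : Sylow q G, (P : Subgroup G) ≤ H) : H = ⊤ := by
  by_contra hH
  obtain ⟨q, hq, hdvd⟩ := Nat.exists_prime_and_dvd (mt Subgroup.index_eq_one.mp hH)
  have : Fact q.Prime := ⟨hq⟩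
  obtain ⟨P, hP⟩ := h q hq
  exact P.not_dvd_index (hdvd.trans (Subgroup.index_dvd_of_le hP))

theorem _root_.Group.IsNilpotent.commute_of_isPGroup {G : Type*} [Group G] [Finite G]
    (hnil : Group.IsNilpotent G) {p q : ℕ} [Fact p.Prime] [Fact q.Prime] (hpq : p ≠ q)
    (P : Sylow p G) (Q : Sylow q G) {a b : G} (ha : a ∈ P) (hb : b ∈ Q) : Commute a b := by
  have hn := Group.normalizerCondition_of_isNilpotent (G := G)
  exact Subgroup.commute_of_normal_of_disjoint _ _ (P.normal_of_normalizerCondition hn)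
    (Q.normal_of_normalizerCondition hn) (IsPGroup.disjoint_of_ne p q hpq _ _ P.2 Q.2) a b ha hb

theorem exists_mem_zeta_one_ne_zero [Finite B] [Nontrivial B]
    (hnilAdd : Group.IsNilpotent (Multiplicative B)) (hnilMul : Group.IsNilpotent B)
    (hstar : ∀ b : B, sstar b b = 0) : ∃ x ∈ zeta B 1, x ≠ 0 := by
  obtain ⟨p, hp, hdvd⟩ := exists_prime_dvd_card_centralTorsion hnilAdd
  have : Fact p.Prime := ⟨hp⟩
  let P : Sylow p B := default
  obtain ⟨a, ha, ha0⟩ := P.2.exists_fixed_point_of_prime_dvd_card_of_fixed_point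
    (centralTorsion B p) hdvd (a := 0) (fun g => Subtype.ext (map_zero (lam B (g : B))))
  have hstab : MulAction.stabilizer B a = ⊤ := by
    refine Subgroup.eq_top_of_forall_sylow_le _ fun q hq => ?_
    have : Fact q.Prime := ⟨hq⟩
    by_cases hpq : p = q
    · subst hpq
      exact ⟨P, fun g hg => ha ⟨g, hg⟩⟩
    · let Q : Sylow q B := default
      refine ⟨Q, fun b hb => ?_⟩
      obtain ⟨k, hk⟩ := Q.2 ⟨b, hb⟩
      have hap : IsPGroup p (Subgroup.zpowers (a : B)) := IsPGroup.iff_card.mpr <| by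
        have h : (a : B) ^ p = 1 := by rw [pow_eq_nsmul hstar, a.2.2, one_eq_zero]
        rw [Nat.card_zpowers]
        obtain ⟨k, -, hk⟩ := (Nat.dvd_prime_pow hp).mp
          ((orderOf_dvd_of_pow_eq_one h).trans (dvd_of_eq (pow_one p).symm))
        exact ⟨k, hk⟩
      obtain ⟨P', hP'⟩ := hap.exists_le_sylow
      exact smul_eq_of_commute hstar (((Nat.coprime_primes hp hq).mpr hpq).pow_right k) a
        (congrArg Subtype.val hk)
        (hnilMul.commute_of_isPGroup hpq P' Q (hP' (Subgroup.mem_zpowers _)) hb)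
  have hfix : ∀ b, lam B b a = a := fun b => congrArg Subtype.val
    (show b • a = a from (hstab ▸ Subgroup.mem_top b : b ∈ MulAction.stabilizer B a))
  refine ⟨a, mem_zeta_one.mpr fun b => ?_, fun h => ha0 (Subtype.ext h.symm)⟩
  have h1 : (a : B) * b = a + b := by rw [mul_eq_add_lam, lam_eq_of_fixed hstar hfix]
  have h2 : b * (a : B) = b + a := by rw [mul_eq_add_lam, hfix]
  exact ⟨h1, a.2.1 b, by rw [h1, h2, a.2.1]⟩

/-- Membership in the upper central series is detected on a quotient by the first term. -/
theorem mem_zeta_of_surjective {C : Type*} [SkewBrace C] (f : B → C) (hf : Function.Surjective f)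
    (hadd : ∀ x y, f (x + y) = f x + f y) (hmul : ∀ x y, f (x * y) = f x * f y)
    (hker : ∀ x, f x = 0 ↔ x ∈ zeta B 1) (n : ℕ) (x : B) :
    f x ∈ zeta C n ↔ x ∈ zeta B (n + 1) := by
  induction n generalizing x with
  | zero => exact hker x
  | succ n ih =>
    have hneg : ∀ x, f (-x) = -f x := map_neg (AddMonoidHom.mk' f hadd)
    have hinv : ∀ x, f x⁻¹ = (f x)⁻¹ := map_inv (MonoidHom.mk' f hmul)
    rw [zeta, zeta, Set.mem_ofPred_eq, Set.mem_ofPred_eq, hf.forall]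
    simp only [← hadd, ← hmul, ← hneg, ← hinv, ih]

theorem mul_eq_add_of_mem {x : B} (hx : x ∈ zeta B 1) (b : B) : x * b = x + b :=
  (mem_zeta_one.mp hx b).1

theorem add_comm_of_mem {x : B} (hx : x ∈ zeta B 1) (b : B) : x + b = b + x :=
  (mem_zeta_one.mp hx b).2.1

theorem mul_comm_of_mem {x : B} (hx : x ∈ zeta B 1) (b : B) : x * b = b * x :=
  (mem_zeta_one.mp hx b).2.2

theorem inv_eq_neg_of_mem {x : B} (hx : x ∈ zeta B 1) : x⁻¹ = -x := by
  rw [eq_neg_iff_add_eq_zero, ← add_comm_of_mem hx, ← mul_eq_add_of_mem hx, mul_inv_cancel,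
    one_eq_zero]

/-- The first term of the upper central series, as a subgroup of the multiplicative group. -/
def zetaOne (B : Type*) [SkewBrace B] : Subgroup B where
  carrier := zeta B 1
  one_mem' := mem_zeta_one.mpr fun b =>
    ⟨by rw [one_mul, one_eq_zero, zero_add], by rw [one_eq_zero, zero_add, add_zero],
      by rw [one_mul, mul_one]⟩
  mul_mem' := fun {x y} hx hy => mem_zeta_one.mpr fun b => by
    refine ⟨?_, ?_, ?_⟩
    · rw [mul_assoc, mul_eq_add_of_mem hx, mul_eq_add_of_mem hy, mul_eq_add_of_mem hx, add_assoc]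
    · rw [mul_eq_add_of_mem hx, add_assoc, add_comm_of_mem hy, ← add_assoc, add_comm_of_mem hx,
        add_assoc]
    · rw [mul_assoc, mul_comm_of_mem hy, ← mul_assoc, mul_comm_of_mem hx, mul_assoc]
  inv_mem' := fun {x} hx => mem_zeta_one.mpr fun b => by
    refine ⟨?_, ?_, ?_⟩
    · rw [inv_mul_eq_iff_eq_mul, mul_eq_add_of_mem hx, inv_eq_neg_of_mem hx, add_neg_cancel_left]
    · rw [inv_eq_neg_of_mem hx, neg_add_eq_iff_eq_add, ← add_assoc, add_comm_of_mem hx,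
        add_neg_cancel_right]
    · rw [inv_mul_eq_iff_eq_mul, ← mul_assoc, mul_comm_of_mem hx, mul_inv_cancel_right]

instance : (zetaOne B).Normal :=
  ⟨fun x hx g => by rwa [← mul_comm_of_mem hx, mul_inv_cancel_right]⟩

theorem leftRel_zetaOne_iff {a b : B} :
    QuotientGroup.leftRel (zetaOne B) a b ↔ ∃ x ∈ zetaOne B, b = a + x := by
  rw [QuotientGroup.leftRel_apply]
  constructor
  · intro h
    refine ⟨_, h, ?_⟩
    rw [← add_comm_of_mem h, ← mul_eq_add_of_mem h, mul_comm_of_mem h, mul_inv_cancel_left]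
  · rintro ⟨x, hx, rfl⟩
    rwa [← add_comm_of_mem hx, ← mul_eq_add_of_mem hx, mul_comm_of_mem hx, inv_mul_cancel_left]

instance : Zero (B ⧸ zetaOne B) := ⟨QuotientGroup.mk 0⟩

instance : Add (B ⧸ zetaOne B) :=
  ⟨Quotient.map₂ (· + ·) fun a a' ha b b' hb => by
    obtain ⟨x, hx, rfl⟩ := leftRel_zetaOne_iff.mp ha
    obtain ⟨y, hy, rfl⟩ := leftRel_zetaOne_iff.mp hb
    refine leftRel_zetaOne_iff.mpr ⟨x * y, mul_mem hx hy, ?_⟩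
    rw [mul_eq_add_of_mem hx, add_assoc, ← add_assoc x, add_comm_of_mem hx, add_assoc b,
      add_assoc a]⟩

instance : Neg (B ⧸ zetaOne B) :=
  ⟨Quotient.map (- ·) fun a a' ha => by
    obtain ⟨x, hx, rfl⟩ := leftRel_zetaOne_iff.mp ha
    refine leftRel_zetaOne_iff.mpr ⟨x⁻¹, inv_mem hx, ?_⟩
    rw [neg_add_rev, ← inv_eq_neg_of_mem hx, add_comm_of_mem (inv_mem hx : x⁻¹ ∈ zetaOne B)]⟩

instance : AddGroup (B ⧸ zetaOne B) :=
  AddGroup.ofLeftAxioms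
    (by rintro ⟨a⟩ ⟨b⟩ ⟨c⟩; exact congrArg QuotientGroup.mk (add_assoc a b c))
    (by rintro ⟨a⟩; exact congrArg QuotientGroup.mk (zero_add a))
    (by rintro ⟨a⟩; exact congrArg QuotientGroup.mk (neg_add_cancel a))

instance : SkewBrace (B ⧸ zetaOne B) where
  skew := by
    rintro ⟨a⟩ ⟨b⟩ ⟨c⟩
    exact congrArg QuotientGroup.mk
      ((skew a b c).trans (congrArg (· + a * c) (sub_eq_add_neg (a * b) a)))

theorem mk_eq_zero_iff (x : B) : (x : B ⧸ zetaOne B) = 0 ↔ x ∈ zeta B 1 := by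
  rw [← one_eq_zero]
  exact QuotientGroup.eq_one_iff x

theorem centrallyNilpotent_of_quotient (h : CentrallyNilpotent (B ⧸ zetaOne B)) :
    CentrallyNilpotent B := by
  obtain ⟨n, hn⟩ := h
  refine ⟨n + 1, Set.eq_univ_of_forall fun x => ?_⟩
  rw [← mem_zeta_of_surjective (QuotientGroup.mk (s := zetaOne B)) QuotientGroup.mk_surjective
    (fun _ _ => rfl) (fun _ _ => rfl) mk_eq_zero_iff, hn]
  trivial

theorem centrallyNilpotent_of_sstar_self (B : Type*) [SkewBrace B] [Finite B]
    (hnilAdd : Group.IsNilpotent (Multiplicative B)) (hnilMul : Group.IsNilpotent B)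
    (hstar : ∀ b : B, sstar b b = 0) : CentrallyNilpotent B := by
  induction hn : Nat.card B using Nat.strong_induction_on generalizing B with
  | _ n ih =>
    rcases subsingleton_or_nontrivial B with hB | hB
    · exact ⟨0, Set.eq_univ_of_forall fun x => Subsingleton.elim x 0⟩
    obtain ⟨x, hx, hx0⟩ := exists_mem_zeta_one_ne_zero hnilAdd hnilMul hstar
    have hbot : Nontrivial (zetaOne B) :=
      ⟨⟨x, hx⟩, 1, fun h => hx0 ((congrArg Subtype.val h).trans one_eq_zero)⟩
    let f : Multiplicative B →* Multiplicative (B ⧸ zetaOne B) :=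
      AddMonoidHom.toMultiplicative (AddMonoidHom.mk' (QuotientGroup.mk (s := zetaOne B))
        fun _ _ => rfl)
    have hf : Function.Surjective f := fun y =>
      (QuotientGroup.mk_surjective y.toAdd).imp fun _ h => congrArg Multiplicative.ofAdd h
    refine centrallyNilpotent_of_quotient (ih _ ?_ (B ⧸ zetaOne B)
      (Group.nilpotent_of_surjective (h := hnilAdd) f hf)
      (Group.nilpotent_of_surjective (h := hnilMul) (QuotientGroup.mk' (zetaOne B))
        QuotientGroup.mk_surjective)
      ?_ rfl)
    · rw [← hn, (zetaOne B).card_eq_card_quotient_mul_card_subgroup]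
      exact lt_mul_of_one_lt_right Nat.card_pos Finite.one_lt_card
    · rintro ⟨b⟩
      exact congrArg QuotientGroup.mk ((sub_eq_add_neg (-b + b * b) b).symm.trans (hstar b))

end SkewBrace

/-- A finite skew brace of nilpotent type (additive group nilpotent) whose
multiplicative group is also nilpotent and in which `b ∗ b = 0` for all `b`
is centrally nilpotent. -/
theorem statement1 (B : Type*) [SkewBrace B] [Fintype B]
    (hnilAdd : Group.IsNilpotent (Multiplicative B))
    (hnilMul : Group.IsNilpotent B)
    (hstar : ∀ b : B, sstar b b = 0) :
    CentrallyNilpotent B := by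
  exact SkewBrace.centrallyNilpotent_of_sstar_self B hnilAdd hnilMul hstar
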